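/- Let 1 ≤ θ < ∞, 1 ≤ r < p < ∞, 1/r − 1/p < α < 1, and β = α − 1/r + 1/p. Then for any f in the mixed-norm Besov space with ‖f‖ = ‖f‖_{L^p[L^r]} + (∫₀^∞ [h^{-α} ‖Δ₁(h)f‖_{L^p[L^r]}]^θ dh/h)^{1/θ} < ∞ (defined on ℝⁿ, n ≥ 2), one has both ‖f‖_{L^p(ℝⁿ)} ≤ c ‖f‖ and ∫₀^∞ h^{-θβ} ‖Δ₁(h)f‖_{L^p(ℝⁿ)}^θ dh/h ≤ c ∫₀^∞ h^{-θα} ‖Δ₁(h)f‖_{L^p[L^r]}^θ dh/h. -/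

import Mathlib

open MeasureTheory ENNReal Set
noncomputable section

/-- Nonincreasing rearrangement of an ℝ≥0∞-valued function. -/
def rearr {α : Type*} [MeasurableSpace α] (μ : Measure α) (f : α → ℝ≥0∞) (t : ℝ) : ℝ≥0∞ :=
  sInf {y : ℝ≥0∞ | μ {x | y < f x} ≤ ENNReal.ofReal t}

/-- Lorentz L^{p,ν} functional: (∫₀^∞ (t^{1/p} f*(t))^ν dt/t)^{1/ν}. -/
def lorentz {α : Type*} [MeasurableSpace α] (μ : Measure α) (f : α → ℝ≥0∞)
    (p ν : ℝ) : ℝ≥0∞ :=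
  (∫⁻ t in Set.Ioi (0:ℝ),
    (ENNReal.ofReal (t ^ (1/p)) * rearr μ f t) ^ ν / ENNReal.ofReal t) ^ (1/ν)

/-- Δ₁(h)f(x,y) = f(x+h,y) − f(x,y). -/
def Delta1 {n : ℕ} (h : ℝ) (f : ℝ × (Fin n → ℝ) → ℝ) : ℝ × (Fin n → ℝ) → ℝ :=
  fun z => f (z.1 + h, z.2) - f z

/-- Mixed norm L^p[L^r]: first the L^r(ℝ) norm in x, then the L^p(ℝ^{n-1}) norm in y. -/
def mixedLpLr {n : ℕ} (p r : ℝ) (f : ℝ × (Fin n → ℝ) → ℝ) : ℝ≥0∞ :=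
  (∫⁻ y : Fin n → ℝ,
    ((∫⁻ x : ℝ, (‖f (x, y)‖₊ : ℝ≥0∞) ^ r) ^ (p/r))) ^ (1/p)

/-- Minkowski's inequality for countable sums of nonnegative functions. -/
theorem lintegral_tsum_rpow_le {X : Type*} [MeasurableSpace X] {μ : Measure X}
    {F : ℕ → X → ℝ≥0∞} (hF : ∀ k, Measurable (F k)) {p : ℝ} (hp : 1 ≤ p) :
    (∫⁻ a, (∑' k, F k a) ^ p ∂μ) ^ (1 / p) ≤ ∑' k, (∫⁻ a, F k a ^ p ∂μ) ^ (1 / p) := by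
  have hp0 : 0 < p := by linarith
  have hpartial (n : ℕ) : (∫⁻ a, (∑ k ∈ Finset.range n, F k a) ^ p ∂μ) ^ (1 / p) ≤
      ∑ k ∈ Finset.range n, (∫⁻ a, F k a ^ p ∂μ) ^ (1 / p) := by
    induction n with
    | zero => simp [hp0]
    | succ n ih =>
      simp only [Finset.sum_range_succ]
      refine le_trans ?_ (add_le_add_left ih _)
      exact ENNReal.lintegral_Lp_add_le
        (Finset.measurable_fun_sum _ fun k _ => hF k).aemeasurable (hF n).aemeasurable hp
  have hsup : ∫⁻ a, (∑' k, F k a) ^ p ∂μ =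
      ⨆ n : ℕ, ∫⁻ a, (∑ k ∈ Finset.range n, F k a) ^ p ∂μ := by
    rw [← lintegral_iSup]
    · refine lintegral_congr fun a => ?_
      rw [ENNReal.tsum_eq_iSup_nat]
      exact (ENNReal.orderIsoRpow p hp0).map_iSup _
    · exact fun n => (Finset.measurable_fun_sum _ fun k _ => hF k).pow_const p
    · intro m n hmn a
      exact ENNReal.rpow_le_rpow (Finset.sum_le_sum_of_subset (by simpa using hmn)) hp0.le
  rw [one_div, ENNReal.rpow_inv_le_iff hp0, hsup]
  refine iSup_le fun n => ?_
  rw [← ENNReal.rpow_inv_le_iff hp0, ← one_div]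
  exact (hpartial n).trans (ENNReal.sum_le_tsum _)

/-- The measure `dt / t` on the half line is invariant under dilations. -/
theorem setLIntegral_Ioi_comp_mul_div (ψ : ℝ → ℝ≥0∞) {c : ℝ} (hc : 0 < c) :
    ∫⁻ t in Ioi (0 : ℝ), ψ (c * t) / ENNReal.ofReal t =
      ∫⁻ t in Ioi (0 : ℝ), ψ t / ENNReal.ofReal t := by
  rw [← lintegral_indicator measurableSet_Ioi, ← lintegral_indicator measurableSet_Ioi]
  conv_rhs => rw [← Real.smul_map_volume_mul_left hc.ne']
  rw [lintegral_smul_measure, (measurableEmbedding_mulLeft₀ hc.ne').lintegral_map, smul_eq_mul,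
    ← lintegral_const_mul' _ _ ENNReal.ofReal_ne_top, abs_of_pos hc]
  refine lintegral_congr fun t => ?_
  by_cases ht : 0 < t
  · have h1 : ENNReal.ofReal c ≠ 0 := by simpa using hc
    rw [indicator_of_mem (mem_Ioi.2 ht), indicator_of_mem (mem_Ioi.2 (mul_pos hc ht)),
      ENNReal.ofReal_mul hc.le, div_eq_mul_inv, div_eq_mul_inv,
      ENNReal.mul_inv (Or.inl h1) (Or.inl ENNReal.ofReal_ne_top),
      mul_comm (ENNReal.ofReal c)⁻¹, ← mul_assoc, mul_comm (ENNReal.ofReal c), mul_assoc,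
      mul_left_comm (ENNReal.ofReal c), ENNReal.mul_inv_cancel h1 ENNReal.ofReal_ne_top, mul_one]
  · rw [indicator_of_notMem (by simpa using ht), indicator_of_notMem, mul_zero]
    simp only [mem_Ioi, not_lt] at ht ⊢
    exact mul_nonpos_of_nonneg_of_nonpos hc.le ht

/-- A geometrically weighted sum of dilations is bounded on `L^θ(dt / t)`. -/
theorem lintegral_tsum_dilation_le {φ : ℝ → ℝ≥0∞} (hφ : Measurable φ) {θ : ℝ} (hθ : 1 ≤ θ)
    (q : ℝ≥0∞) :
    ∫⁻ t in Ioi (0 : ℝ), (∑' k : ℕ, q ^ k * φ ((2 ^ k)⁻¹ * t)) ^ θ / ENNReal.ofReal t ≤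
      ((1 - q)⁻¹) ^ θ * ∫⁻ t in Ioi (0 : ℝ), φ t ^ θ / ENNReal.ofReal t := by
  have hθ0 : 0 < θ := by linarith
  set ν : Measure ℝ :=
    (volume.restrict (Ioi (0 : ℝ))).withDensity fun t => (ENNReal.ofReal t)⁻¹ with hν
  have hdens (ψ : ℝ → ℝ≥0∞) (hψ : Measurable ψ) :
      ∫⁻ t in Ioi (0 : ℝ), ψ t / ENNReal.ofReal t = ∫⁻ t, ψ t ∂ν := by
    rw [hν, lintegral_withDensity_eq_lintegral_mul _ (by fun_prop) hψ]
    exact lintegral_congr fun t => by rw [Pi.mul_apply, div_eq_mul_inv, mul_comm]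
  have hdil (k : ℕ) : Measurable fun t => φ ((2 ^ k : ℝ)⁻¹ * t) :=
    hφ.comp (measurable_const_mul _)
  have hterm (k : ℕ) : (∫⁻ t, (q ^ k * φ ((2 ^ k)⁻¹ * t)) ^ θ ∂ν) ^ (1 / θ) =
      q ^ k * (∫⁻ t, φ t ^ θ ∂ν) ^ (1 / θ) := by
    simp_rw [ENNReal.mul_rpow_of_nonneg _ _ hθ0.le]
    rw [lintegral_const_mul _ ((hdil k).pow_const θ), ENNReal.mul_rpow_of_nonneg _ _ (by positivity),
      ← ENNReal.rpow_mul, mul_one_div_cancel hθ0.ne', ENNReal.rpow_one,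
      ← hdens _ (hφ.pow_const θ), ← hdens _ ((hdil k).pow_const θ),
      setLIntegral_Ioi_comp_mul_div (fun t => φ t ^ θ) (by positivity)]
  have hmink := lintegral_tsum_rpow_le (μ := ν)
    (F := fun k t => q ^ k * φ ((2 ^ k)⁻¹ * t)) (fun k => (hdil k).const_mul _) hθ
  simp_rw [hterm, ENNReal.tsum_mul_right, ENNReal.tsum_geometric] at hmink
  rw [hdens _ ((Measurable.tsum fun k => (hdil k).const_mul _).pow_const θ),
    hdens _ (hφ.pow_const θ)]
  rw [one_div, ENNReal.rpow_inv_le_iff hθ0, ENNReal.mul_rpow_of_nonneg _ _ hθ0.le,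
    ← ENNReal.rpow_mul, inv_mul_cancel₀ hθ0.ne', ENNReal.rpow_one] at hmink
  exact hmink

/-- The mean of `φ` over the interval `(x, x + t]`. -/
def forwardMean (φ : ℝ → ℝ≥0∞) (t x : ℝ) : ℝ≥0∞ :=
  (ENNReal.ofReal t)⁻¹ * ∫⁻ u in Ioc 0 t, φ (x + u)

theorem forwardMean_rpow_le {φ : ℝ → ℝ≥0∞} (hφ : Measurable φ) {r t : ℝ} (hr : 1 ≤ r) (ht : 0 < t)
    (x : ℝ) : forwardMean φ t x ^ r ≤ forwardMean (fun u => φ u ^ r) t x := by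
  have hr0 : 0 < r := by linarith
  set ν : Measure ℝ := (ENNReal.ofReal t)⁻¹ • volume.restrict (Ioc 0 t) with hν
  have : IsProbabilityMeasure ν := ⟨by
    simp only [hν, Measure.smul_apply, Measure.restrict_apply_univ, Real.volume_Ioc, sub_zero,
      smul_eq_mul]
    exact ENNReal.inv_mul_cancel (by simpa using ht) ENNReal.ofReal_ne_top⟩
  have h := eLpNorm'_le_eLpNorm'_of_exponent_le one_pos hr ν
    (hφ.comp (measurable_const_add x)).aestronglyMeasurable
  simp only [eLpNorm', enorm_eq_self, ENNReal.rpow_one, one_div, inv_one, Function.comp_apply] at h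
  rw [ENNReal.le_rpow_inv_iff hr0] at h
  simpa [hν, lintegral_smul_measure, forwardMean] using h

theorem lintegral_forwardMean {φ : ℝ → ℝ≥0∞} (hφ : Measurable φ) {t : ℝ} (ht : 0 < t) :
    ∫⁻ x, forwardMean φ t x = ∫⁻ x, φ x := by
  simp only [forwardMean]
  rw [lintegral_const_mul' _ _ (by simpa using ht),
    lintegral_lintegral_swap (f := fun x u => φ (x + u))
      (hφ.comp (measurable_fst.add measurable_snd)).aemeasurable]
  simp_rw [lintegral_add_right_eq_self φ]
  rw [setLIntegral_const, Real.volume_Ioc, sub_zero, mul_comm, mul_assoc,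
    ENNReal.mul_inv_cancel (by simpa using ht) ENNReal.ofReal_ne_top, mul_one]

/-- Young's inequality for the interval mean: it maps `L^r` to `L^p` for `r < p`. -/
theorem lintegral_forwardMean_rpow_le {φ : ℝ → ℝ≥0∞} (hφ : Measurable φ) {r p t : ℝ} (hr : 1 ≤ r)
    (hrp : r < p) (ht : 0 < t) :
    ∫⁻ x, forwardMean φ t x ^ p ≤
      ENNReal.ofReal (t ^ (-((p - r) / r))) * (∫⁻ x, φ x ^ r) ^ (p / r) := by
  have hr0 : 0 < r := by linarith
  set I := ∫⁻ x, φ x ^ r with hI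
  have hsup (x : ℝ) : forwardMean φ t x ^ r ≤ (ENNReal.ofReal t)⁻¹ * I := by
    refine (forwardMean_rpow_le hφ hr ht x).trans ?_
    unfold forwardMean
    gcongr
    refine (setLIntegral_le_lintegral _ _).trans ?_
    rw [lintegral_add_left_eq_self (fun u => φ u ^ r) x]
  calc ∫⁻ x, forwardMean φ t x ^ p
      ≤ ∫⁻ x, ((ENNReal.ofReal t)⁻¹ * I) ^ ((p - r) / r) *
          forwardMean (fun u => φ u ^ r) t x := by
        refine lintegral_mono fun x => ?_
        have : forwardMean φ t x ^ p =
            (forwardMean φ t x ^ r) ^ ((p - r) / r) * forwardMean φ t x ^ r := by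
          rw [← ENNReal.rpow_mul, mul_div_cancel₀ _ hr0.ne',
            ← ENNReal.rpow_add_of_nonneg _ _ (by linarith) hr0.le]
          congr 1; ring
        rw [this]
        gcongr
        · exact hsup x
        · exact forwardMean_rpow_le hφ hr ht x
    _ ≤ ((ENNReal.ofReal t)⁻¹ * I) ^ ((p - r) / r) * I := by
        rw [lintegral_const_mul, lintegral_forwardMean (hφ.pow_const r) ht]
        unfold forwardMean
        exact (Measurable.lintegral_prod_right'
          (f := fun z : ℝ × ℝ => φ (z.1 + z.2) ^ r) (by fun_prop)).const_mul _
    _ = _ := by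
        have hs : 0 ≤ (p - r) / r := div_nonneg (by linarith) hr0.le
        rw [ENNReal.mul_rpow_of_nonneg _ _ hs, mul_assoc]
        congr 1
        · rw [← ENNReal.ofReal_inv_of_pos ht, ENNReal.ofReal_rpow_of_pos (by positivity),
            Real.inv_rpow ht.le, Real.rpow_neg ht.le]
        · conv_lhs => rw [← ENNReal.rpow_one I, ← ENNReal.rpow_mul, one_mul,
            ← ENNReal.rpow_add_of_nonneg _ _ hs zero_le_one]
          congr 1; field_simp; ring

theorem locallyIntegrable_of_lintegral_rpow_lt_top {g : ℝ → ℝ} (hg : Measurable g) {r : ℝ}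
    (hr : 1 ≤ r) (h : ∫⁻ x, ‖g x‖ₑ ^ r < ∞) : LocallyIntegrable g := by
  have hr0 : 0 < r := by linarith
  have : MemLp g (ENNReal.ofReal r) := by
    refine ⟨hg.aestronglyMeasurable, ?_⟩
    rw [eLpNorm_eq_lintegral_rpow_enorm_toReal (by simpa using hr0) ENNReal.ofReal_ne_top,
      ENNReal.toReal_ofReal hr0.le]
    exact ENNReal.rpow_lt_top_of_nonneg (by positivity) h.ne
  exact this.locallyIntegrable (by simpa using hr)

theorem enorm_intervalIntegral_div_le (g : ℝ → ℝ) {t : ℝ} (ht : 0 < t) (x : ℝ) :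
    ‖(∫ u in x..x + t, g u) / t‖ₑ ≤ forwardMean (fun u => ‖g u‖ₑ) t x := by
  have : ∫ u in x..x + t, g u = ∫ u in Ioc 0 t, g (x + u) := by
    rw [← intervalIntegral.integral_of_le ht.le, intervalIntegral.integral_comp_add_left]
    simp
  rw [this, div_eq_inv_mul, enorm_mul, forwardMean, Real.enorm_eq_ofReal (by positivity),
    ENNReal.ofReal_inv_of_pos ht]
  gcongr
  exact enorm_integral_le_lintegral_enorm _

/-- Telescoping dyadic means and Lebesgue differentiation bound a function pointwise by means of
itself and of its differences. -/
theorem ae_enorm_le_forwardMean_add_tsum {g : ℝ → ℝ} (hg : LocallyIntegrable g) {t : ℝ}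
    (ht : 0 < t) :
    ∀ᵐ x, ‖g x‖ₑ ≤ forwardMean (fun u => ‖g u‖ₑ) t x +
      ∑' k : ℕ, forwardMean (fun u => ‖g (u + (2 ^ (k + 1))⁻¹ * t) - g u‖ₑ)
        ((2 ^ (k + 1))⁻¹ * t) x := by
  have hint (a b : ℝ) : IntervalIntegrable g volume a b :=
    intervalIntegrable_iff.mpr <|
      (hg.integrableOn_isCompact isCompact_uIcc).mono_set uIoc_subset_uIcc
  filter_upwards [_root_.LocallyIntegrable.ae_hasDerivAt_integral hg] with x hx
  set s : ℕ → ℝ := fun k => (2 ^ k)⁻¹ * t with hs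
  have hs0 (k : ℕ) : 0 < s k := by positivity
  have hss (k : ℕ) : s k = 2 * s (k + 1) := by simp only [hs, pow_succ]; field_simp
  set A : ℕ → ℝ := fun k => (∫ u in x..x + s k, g u) / s k with hA
  have hstep (k : ℕ) : A (k + 1) = A k -
      (∫ u in x..x + s (k + 1), (g (u + s (k + 1)) - g u)) / s (k + 1) / 2 := by
    have hshift : IntervalIntegrable (fun u => g (u + s (k + 1))) volume x (x + s (k + 1)) := by
      simpa using (hint (x + s (k + 1)) (x + s (k + 1) + s (k + 1))).comp_add_right (s (k + 1))
        (h := enorm_ne_top)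
    simp only [hA]
    rw [intervalIntegral.integral_sub hshift (hint _ _),
      intervalIntegral.integral_comp_add_right, hss k,
      ← intervalIntegral.integral_add_adjacent_intervals (hint x (x + s (k + 1)))
        (hint _ (x + 2 * s (k + 1))),
      show x + s (k + 1) + s (k + 1) = x + 2 * s (k + 1) by ring]
    have := (hs0 (k + 1)).ne'
    field_simp
    ring
  have hbound (k : ℕ) : ‖A k‖ₑ ≤ forwardMean (fun u => ‖g u‖ₑ) t x +
      ∑ j ∈ Finset.range k, forwardMean (fun u => ‖g (u + s (j + 1)) - g u‖ₑ) (s (j + 1)) x := by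
    induction k with
    | zero => simpa [hA, hs] using enorm_intervalIntegral_div_le g ht x
    | succ k ih =>
      rw [hstep, Finset.sum_range_succ, ← add_assoc]
      refine enorm_sub_le.trans (add_le_add ih ?_)
      refine le_trans ?_ (enorm_intervalIntegral_div_le _ (hs0 (k + 1)) x)
      rw [div_eq_mul_inv _ (2 : ℝ), enorm_mul]
      refine mul_le_of_le_one_right' ?_
      rw [Real.enorm_eq_ofReal (by norm_num)]
      exact ENNReal.ofReal_le_one.2 (by norm_num)
  have hlim : Filter.Tendsto A Filter.atTop (nhds (g x)) := by
    have hs_lim : Filter.Tendsto s Filter.atTop (nhdsWithin 0 (Ioi 0)) := by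
      refine tendsto_nhdsWithin_iff.2 ⟨?_, Filter.Eventually.of_forall hs0⟩
      have := (tendsto_pow_atTop_nhds_zero_of_lt_one (r := (2 : ℝ)⁻¹) (by norm_num)
        (by norm_num)).mul_const t
      simpa [hs, inv_pow] using this
    have := (hx x).tendsto_slope_zero_right.comp hs_lim
    refine this.congr fun k => ?_
    simp [hA, div_eq_inv_mul]
  refine le_of_tendsto ((continuous_enorm.tendsto _).comp hlim)
    (Filter.Eventually.of_forall fun k => (hbound k).trans ?_)
  gcongr
  exact ENNReal.sum_le_tsum _

theorem measurable_forwardMean_slice {n : ℕ} {f : ℝ × (Fin n → ℝ) → ℝ} (hf : Measurable f)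
    (t : ℝ) : Measurable fun z : ℝ × (Fin n → ℝ) =>
      forwardMean (fun u => ‖f (u, z.2)‖ₑ) t z.1 := by
  unfold forwardMean
  exact (Measurable.lintegral_prod_right'
    (f := fun w : (ℝ × (Fin n → ℝ)) × ℝ => ‖f (w.1.1 + w.2, w.1.2)‖ₑ) (by fun_prop)).const_mul _

theorem measurable_Delta1 {n : ℕ} {f : ℝ × (Fin n → ℝ) → ℝ} (hf : Measurable f) (h : ℝ) :
    Measurable (Delta1 h f) := by
  unfold Delta1
  fun_prop

theorem measurable_mixedLpLr_Delta1 {n : ℕ} {f : ℝ × (Fin n → ℝ) → ℝ} (hf : Measurable f)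
    (p r : ℝ) : Measurable fun h => mixedLpLr p r (Delta1 h f) := by
  unfold mixedLpLr Delta1
  refine Measurable.pow_const ?_ _
  refine Measurable.lintegral_prod_right' (f := fun w : ℝ × (Fin n → ℝ) =>
    (∫⁻ x : ℝ, (‖f (x + w.1, w.2) - f (x, w.2)‖₊ : ℝ≥0∞) ^ r) ^ (p / r)) ?_
  refine Measurable.pow_const ?_ _
  exact Measurable.lintegral_prod_right' (f := fun w : (ℝ × (Fin n → ℝ)) × ℝ =>
    (‖f (w.2 + w.1.1, w.1.2) - f (w.2, w.1.2)‖₊ : ℝ≥0∞) ^ r) (by fun_prop)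

theorem lintegral_forwardMean_slice_rpow_le {n : ℕ} {f : ℝ × (Fin n → ℝ) → ℝ}
    (hf : Measurable f) {r p t : ℝ} (hr : 1 ≤ r) (hrp : r < p) (ht : 0 < t) :
    (∫⁻ z : ℝ × (Fin n → ℝ), forwardMean (fun u => ‖f (u, z.2)‖ₑ) t z.1 ^ p) ^ (1 / p) ≤
      ENNReal.ofReal (t ^ (-(1 / r - 1 / p))) * mixedLpLr p r f := by
  have hr0 : 0 < r := by linarith
  have hp0 : 0 < p := by linarith
  have hexp : t ^ (-(1 / r - 1 / p)) = (t ^ (-((p - r) / r))) ^ (1 / p) := by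
    rw [← Real.rpow_mul ht.le]
    congr 1
    field_simp
  rw [hexp, ← ENNReal.ofReal_rpow_of_pos (by positivity), mixedLpLr,
    ← ENNReal.mul_rpow_of_nonneg _ _ (by positivity), Measure.volume_eq_prod,
    lintegral_prod_symm' _ ((measurable_forwardMean_slice hf t).pow_const p),
    ← lintegral_const_mul' _ _ ENNReal.ofReal_ne_top]
  refine ENNReal.rpow_le_rpow (lintegral_mono fun y => ?_) (by positivity)
  exact lintegral_forwardMean_rpow_le (φ := fun u => ‖f (u, y)‖ₑ) (by fun_prop) hr hrp ht

theorem ae_lintegral_slice_lt_top {n : ℕ} {f : ℝ × (Fin n → ℝ) → ℝ} (hf : Measurable f) {r p : ℝ}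
    (hr : 0 < r) (hp : 0 < p) (hfin : mixedLpLr p r f < ∞) :
    ∀ᵐ y, ∫⁻ x, ‖f (x, y)‖ₑ ^ r < ∞ := by
  rw [mixedLpLr, ENNReal.rpow_lt_top_iff_of_pos (by positivity)] at hfin
  have hmeas : Measurable fun y => ∫⁻ x, ‖f (x, y)‖ₑ ^ r :=
    Measurable.lintegral_prod_left' (f := fun z => ‖f z‖ₑ ^ r) (by fun_prop)
  filter_upwards [ae_lt_top (hmeas.pow_const (p / r)) hfin.ne] with y hy
  exact (ENNReal.rpow_lt_top_iff_of_pos (by positivity)).1 hy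

/-- The `L^p` norm is controlled by the mixed norm of the function and of its dyadic
differences. -/
theorem eLpNorm_le_mixedLpLr_add_tsum {n : ℕ} {f : ℝ × (Fin n → ℝ) → ℝ} (hf : Measurable f)
    {r p t : ℝ} (hr : 1 ≤ r) (hrp : r < p) (ht : 0 < t) (hfin : mixedLpLr p r f < ∞) :
    eLpNorm f (ENNReal.ofReal p) volume ≤
      ENNReal.ofReal (t ^ (-(1 / r - 1 / p))) * mixedLpLr p r f +
      ∑' k : ℕ, ENNReal.ofReal (((2 ^ (k + 1))⁻¹ * t) ^ (-(1 / r - 1 / p))) *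
        mixedLpLr p r (Delta1 ((2 ^ (k + 1))⁻¹ * t) f) := by
  have hr0 : 0 < r := by linarith
  have hp0 : 0 < p := by linarith
  set G : ℝ × (Fin n → ℝ) → ℝ≥0∞ := fun z => forwardMean (fun u => ‖f (u, z.2)‖ₑ) t z.1
  set H : ℕ → ℝ × (Fin n → ℝ) → ℝ≥0∞ := fun k z =>
    forwardMean (fun u => ‖Delta1 ((2 ^ (k + 1))⁻¹ * t) f (u, z.2)‖ₑ) ((2 ^ (k + 1))⁻¹ * t) z.1
  have hG : Measurable G := measurable_forwardMean_slice hf t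
  have hH (k : ℕ) : Measurable (H k) := measurable_forwardMean_slice (measurable_Delta1 hf _) _
  have hHsum : Measurable fun z => ∑' k, H k z := Measurable.tsum hH
  rw [eLpNorm_eq_lintegral_rpow_enorm_toReal (by simpa using hp0) ENNReal.ofReal_ne_top,
    ENNReal.toReal_ofReal hp0.le]
  calc (∫⁻ z, ‖f z‖ₑ ^ p) ^ (1 / p)
      ≤ (∫⁻ z, (G z + ∑' k, H k z) ^ p) ^ (1 / p) := by
        refine ENNReal.rpow_le_rpow ?_ (by positivity)
        rw [Measure.volume_eq_prod, lintegral_prod_symm' _ (by fun_prop),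
          lintegral_prod_symm' (fun z => (G z + ∑' k, H k z) ^ p) ((hG.add hHsum).pow_const p)]
        refine lintegral_mono_ae ?_
        filter_upwards [ae_lintegral_slice_lt_top hf hr0 hp0 hfin] with y hy
        have hloc : LocallyIntegrable fun x => f (x, y) :=
          locallyIntegrable_of_lintegral_rpow_lt_top (by fun_prop) hr hy
        refine lintegral_mono_ae ?_
        filter_upwards [ae_enorm_le_forwardMean_add_tsum hloc ht] with x hx
        exact ENNReal.rpow_le_rpow hx hp0.le
    _ ≤ (∫⁻ z, G z ^ p) ^ (1 / p) + (∫⁻ z, (∑' k, H k z) ^ p) ^ (1 / p) :=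
        ENNReal.lintegral_Lp_add_le hG.aemeasurable hHsum.aemeasurable (by linarith)
    _ ≤ (∫⁻ z, G z ^ p) ^ (1 / p) + ∑' k, (∫⁻ z, H k z ^ p) ^ (1 / p) := by
        gcongr
        exact lintegral_tsum_rpow_le hH (by linarith)
    _ ≤ _ := by
        gcongr with k
        · exact lintegral_forwardMean_slice_rpow_le hf hr hrp ht
        · exact lintegral_forwardMean_slice_rpow_le (measurable_Delta1 hf _) hr hrp (by positivity)

theorem mixedLpLr_Delta1_le {n : ℕ} {f : ℝ × (Fin n → ℝ) → ℝ} (hf : Measurable f) {r p : ℝ}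
    (hr : 1 ≤ r) (hp : 0 < p) (h : ℝ) : mixedLpLr p r (Delta1 h f) ≤ 2 * mixedLpLr p r f := by
  have hr0 : 0 < r := by linarith
  have hinner (y : Fin n → ℝ) : ∫⁻ x, (‖Delta1 h f (x, y)‖₊ : ℝ≥0∞) ^ r ≤
      2 ^ r * ∫⁻ x, (‖f (x, y)‖₊ : ℝ≥0∞) ^ r := by
    calc ∫⁻ x, (‖Delta1 h f (x, y)‖₊ : ℝ≥0∞) ^ r
        ≤ ∫⁻ x, 2 ^ (r - 1) * (‖f (x + h, y)‖ₑ ^ r + ‖f (x, y)‖ₑ ^ r) := by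
          refine lintegral_mono fun x => ?_
          refine le_trans (ENNReal.rpow_le_rpow enorm_sub_le hr0.le)
            (ENNReal.rpow_add_le_mul_rpow_add_rpow _ _ hr)
      _ = 2 ^ (r - 1) * (2 * ∫⁻ x, ‖f (x, y)‖ₑ ^ r) := by
          rw [lintegral_const_mul _ (by fun_prop), lintegral_add_left (by fun_prop),
            lintegral_add_right_eq_self (fun x => ‖f (x, y)‖ₑ ^ r) h, two_mul]
      _ = _ := by
          rw [← mul_assoc]
          congr 1
          conv_lhs => rw [← ENNReal.rpow_one (2 : ℝ≥0∞), ← ENNReal.rpow_mul, one_mul,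
            ← ENNReal.rpow_add_of_nonneg _ _ (by linarith) zero_le_one, sub_add_cancel]
  have htwo : (2 : ℝ≥0∞) = (2 ^ p) ^ (1 / p) := by
    rw [← ENNReal.rpow_mul, mul_one_div_cancel hp.ne', ENNReal.rpow_one]
  unfold mixedLpLr
  conv_rhs => rw [htwo]
  rw [← ENNReal.mul_rpow_of_nonneg _ _ (by positivity),
    ← lintegral_const_mul' _ _ (ENNReal.rpow_ne_top_of_nonneg hp.le ENNReal.ofNat_ne_top)]
  refine ENNReal.rpow_le_rpow (lintegral_mono fun y => ?_) (by positivity)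
  refine (ENNReal.rpow_le_rpow (hinner y) (by positivity)).trans_eq ?_
  rw [ENNReal.mul_rpow_of_nonneg _ _ (by positivity), ← ENNReal.rpow_mul,
    mul_div_cancel₀ _ hr0.ne']

theorem Delta1_comm {n : ℕ} (f : ℝ × (Fin n → ℝ) → ℝ) (s h : ℝ) :
    Delta1 s (Delta1 h f) = Delta1 h (Delta1 s f) := by
  ext z
  simp only [Delta1, add_right_comm z.1 s h]
  ring

/-- The dyadic sum of weighted differences below scale `t`. -/
def dyadicDiffSum {n : ℕ} (p r : ℝ) (f : ℝ × (Fin n → ℝ) → ℝ) (t : ℝ) : ℝ≥0∞ :=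
  ∑' k : ℕ, ENNReal.ofReal (((2 ^ k)⁻¹ * t) ^ (-(1 / r - 1 / p))) *
    mixedLpLr p r (Delta1 ((2 ^ k)⁻¹ * t) f)

theorem dyadicDiffSum_eq_add_tsum {n : ℕ} (p r : ℝ) (f : ℝ × (Fin n → ℝ) → ℝ) (t : ℝ) :
    dyadicDiffSum p r f t =
      ENNReal.ofReal (t ^ (-(1 / r - 1 / p))) * mixedLpLr p r (Delta1 t f) +
      ∑' k : ℕ, ENNReal.ofReal (((2 ^ (k + 1))⁻¹ * t) ^ (-(1 / r - 1 / p))) *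
        mixedLpLr p r (Delta1 ((2 ^ (k + 1))⁻¹ * t) f) := by
  rw [dyadicDiffSum, tsum_eq_zero_add' ENNReal.summable, pow_zero, inv_one, one_mul]

theorem eLpNorm_le_dyadicDiffSum {n : ℕ} {f : ℝ × (Fin n → ℝ) → ℝ} (hf : Measurable f)
    {r p t : ℝ} (hr : 1 ≤ r) (hrp : r < p) (ht : 0 < t) (hfin : mixedLpLr p r f < ∞) :
    eLpNorm f (ENNReal.ofReal p) volume ≤
      ENNReal.ofReal (t ^ (-(1 / r - 1 / p))) * mixedLpLr p r f + dyadicDiffSum p r f t := by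
  refine (eLpNorm_le_mixedLpLr_add_tsum hf hr hrp ht hfin).trans ?_
  gcongr
  rw [dyadicDiffSum_eq_add_tsum]
  exact le_add_self

theorem eLpNorm_Delta1_le_dyadicDiffSum {n : ℕ} {f : ℝ × (Fin n → ℝ) → ℝ} (hf : Measurable f)
    {r p t : ℝ} (hr : 1 ≤ r) (hrp : r < p) (ht : 0 < t) (hfin : mixedLpLr p r f < ∞) :
    eLpNorm (Delta1 t f) (ENNReal.ofReal p) volume ≤ 2 * dyadicDiffSum p r f t := by
  have hp0 : 0 < p := by linarith
  have hfin' : mixedLpLr p r (Delta1 t f) < ∞ :=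
    (mixedLpLr_Delta1_le hf hr hp0 t).trans_lt (ENNReal.mul_lt_top ENNReal.ofNat_lt_top hfin)
  refine (eLpNorm_le_mixedLpLr_add_tsum (measurable_Delta1 hf t) hr hrp ht hfin').trans ?_
  rw [dyadicDiffSum_eq_add_tsum, mul_add, ← ENNReal.tsum_mul_left]
  refine add_le_add (le_mul_of_one_le_left zero_le one_le_two)
    (ENNReal.tsum_le_tsum fun k => ?_)
  rw [Delta1_comm, mul_left_comm]
  gcongr
  exact mixedLpLr_Delta1_le (measurable_Delta1 hf _) hr hp0 t

theorem lintegral_dyadicDiffSum_le {n : ℕ} {f : ℝ × (Fin n → ℝ) → ℝ} (hf : Measurable f)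
    {r p α θ : ℝ} (hθ : 1 ≤ θ) :
    ∫⁻ t in Ioi (0 : ℝ), (ENNReal.ofReal (t ^ (-(α - 1 / r + 1 / p))) * dyadicDiffSum p r f t) ^ θ /
        ENNReal.ofReal t ≤
      ((1 - ENNReal.ofReal (2 ^ (-(α - 1 / r + 1 / p))))⁻¹) ^ θ *
        ∫⁻ t in Ioi (0 : ℝ), (ENNReal.ofReal (t ^ (-α)) * mixedLpLr p r (Delta1 t f)) ^ θ /
          ENNReal.ofReal t := by
  refine le_trans (le_of_eq ?_) (lintegral_tsum_dilation_le
    (φ := fun t => ENNReal.ofReal (t ^ (-α)) * mixedLpLr p r (Delta1 t f)) ?_ hθ _)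
  · refine setLIntegral_congr_fun measurableSet_Ioi fun t (ht : 0 < t) => ?_
    simp only [dyadicDiffSum, ← ENNReal.tsum_mul_left]
    congr 3 with k
    rw [← mul_assoc, ← mul_assoc, ← ENNReal.ofReal_pow (by positivity),
      ← ENNReal.ofReal_mul (by positivity), ← ENNReal.ofReal_mul (by positivity)]
    congr 2
    have hk : (0 : ℝ) < (2 ^ k)⁻¹ := by positivity
    rw [Real.mul_rpow hk.le ht.le, Real.mul_rpow hk.le ht.le, ← Real.rpow_natCast,
      ← Real.rpow_natCast, ← Real.rpow_neg two_pos.le, ← Real.rpow_mul two_pos.le,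
      ← Real.rpow_mul two_pos.le, ← Real.rpow_mul two_pos.le, mul_left_comm,
      ← Real.rpow_add ht, ← mul_assoc, ← Real.rpow_add two_pos]
    ring_nf
  · exact (by fun_prop : Measurable fun t : ℝ => ENNReal.ofReal (t ^ (-α))).mul
      (measurable_mixedLpLr_Delta1 hf p r)

/-- If a constant is bounded by a function on `(1, 2]`, it is controlled by the weighted
`L^θ(dt / t)` integral of that function. -/
theorem rpow_le_lintegral_weighted {S : ℝ → ℝ≥0∞} {m : ℝ≥0∞} {β θ : ℝ} (hβ : 0 ≤ β) (hθ : 0 ≤ θ)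
    (hm : ∀ t ∈ Ioc (1 : ℝ) 2, m ≤ S t) :
    m ^ θ ≤ ENNReal.ofReal (2 ^ β) ^ θ * 2 *
      ∫⁻ t in Ioi (0 : ℝ), (ENNReal.ofReal (t ^ (-β)) * S t) ^ θ / ENNReal.ofReal t := by
  have hC : ENNReal.ofReal (2 ^ β) ^ θ * 2 ≠ ∞ :=
    ENNReal.mul_ne_top (ENNReal.rpow_ne_top_of_nonneg hθ ENNReal.ofReal_ne_top)
      ENNReal.ofNat_ne_top
  calc m ^ θ = ∫⁻ _ in Ioc (1 : ℝ) 2, m ^ θ := by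
        rw [setLIntegral_const, Real.volume_Ioc]; norm_num
    _ ≤ ∫⁻ t in Ioc (1 : ℝ) 2, ENNReal.ofReal (2 ^ β) ^ θ * 2 *
          ((ENNReal.ofReal (t ^ (-β)) * S t) ^ θ / ENNReal.ofReal t) := by
        refine setLIntegral_mono' measurableSet_Ioc fun t ht => ?_
        have ht0 : 0 < t := one_pos.trans ht.1
        have h1 : 1 ≤ ENNReal.ofReal (2 ^ β) * ENNReal.ofReal (t ^ (-β)) := by
          rw [← ENNReal.ofReal_mul (by positivity), ENNReal.one_le_ofReal, Real.rpow_neg ht0.le,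
            ← div_eq_mul_inv, one_le_div (by positivity)]
          exact Real.rpow_le_rpow ht0.le ht.2 hβ
        have h2 : 1 ≤ 2 * (ENNReal.ofReal t)⁻¹ := by
          rw [← div_eq_mul_inv, ENNReal.le_div_iff_mul_le (Or.inl (by simpa using ht0))
            (Or.inl ENNReal.ofReal_ne_top), one_mul]
          exact ENNReal.ofReal_le_of_le_toReal (by simpa using ht.2)
        calc m ^ θ ≤ (1 * S t) ^ θ * 1 := by
              rw [one_mul, mul_one]; exact ENNReal.rpow_le_rpow (hm t ht) hθ
          _ ≤ (ENNReal.ofReal (2 ^ β) * ENNReal.ofReal (t ^ (-β)) * S t) ^ θ *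
              (2 * (ENNReal.ofReal t)⁻¹) := by gcongr
          _ = _ := by
              rw [mul_assoc (ENNReal.ofReal (2 ^ β)), ENNReal.mul_rpow_of_nonneg _ _ hθ,
                div_eq_mul_inv]
              ring
    _ ≤ ∫⁻ t in Ioi (0 : ℝ), ENNReal.ofReal (2 ^ β) ^ θ * 2 *
          ((ENNReal.ofReal (t ^ (-β)) * S t) ^ θ / ENNReal.ofReal t) :=
        lintegral_mono_set fun t ht => one_pos.trans ht.1
    _ = _ := lintegral_const_mul' _ _ hC

/-- Proposition 3.1: for 1 ≤ θ < ∞, 1 ≤ r < p < ∞, 1/r − 1/p < α < 1,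
β = α − 1/r + 1/p, every f in the mixed-norm Besov space B^α_{θ;1}(L^p[L^r])
satisfies ‖f‖_p ≤ c ‖f‖_{B^α_{θ;1}(L^p[L^r])} and the Besov seminorm inequality. -/
theorem mixed_besov_embedding (n : ℕ) (hn : 1 ≤ n) (θ r p α : ℝ)
    (hθ : 1 ≤ θ) (hr : 1 ≤ r) (hrp : r < p)
    (hα₁ : 1/r - 1/p < α) (hα₂ : α < 1) :
    ∃ c > 0, ∀ f : ℝ × (Fin n → ℝ) → ℝ, Measurable f →
      mixedLpLr p r f +
        (∫⁻ h in Set.Ioi (0:ℝ),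
          (ENNReal.ofReal (h ^ (-α)) * mixedLpLr p r (Delta1 h f)) ^ θ
            / ENNReal.ofReal h) ^ (1/θ) < ∞ →
      (eLpNorm f (ENNReal.ofReal p) volume
          ≤ ENNReal.ofReal c *
            (mixedLpLr p r f +
              (∫⁻ h in Set.Ioi (0:ℝ),
                (ENNReal.ofReal (h ^ (-α)) * mixedLpLr p r (Delta1 h f)) ^ θ
                  / ENNReal.ofReal h) ^ (1/θ))) ∧
      ∫⁻ h in Set.Ioi (0:ℝ),
          (ENNReal.ofReal (h ^ (-(α - 1/r + 1/p))) *
            eLpNorm (Delta1 h f) (ENNReal.ofReal p) volume) ^ θ / ENNReal.ofReal h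
        ≤ ENNReal.ofReal c *
          ∫⁻ h in Set.Ioi (0:ℝ),
            (ENNReal.ofReal (h ^ (-α)) * mixedLpLr p r (Delta1 h f)) ^ θ
              / ENNReal.ofReal h := by
  have hr0 : 0 < r := by linarith
  have hp0 : 0 < p := by linarith
  have hθ0 : 0 < θ := by linarith
  have hβ : 0 < α - 1 / r + 1 / p := by linarith
  have hδ : 0 ≤ 1 / r - 1 / p := sub_nonneg.2 (one_div_le_one_div_of_le hr0 hrp.le)
  set β := α - 1 / r + 1 / p with hβ_def
  set C : ℝ≥0∞ := ((1 - ENNReal.ofReal (2 ^ (-β)))⁻¹) ^ θ with hC_def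
  have hC : C ≠ ∞ := by
    refine ENNReal.rpow_ne_top_of_nonneg hθ0.le (ENNReal.inv_ne_top.2 (tsub_pos_of_lt ?_).ne')
    rw [ENNReal.ofReal_lt_one]
    exact Real.rpow_lt_one_of_one_lt_of_neg one_lt_two (neg_lt_zero.2 hβ)
  set E : ℝ≥0∞ := (ENNReal.ofReal (2 ^ β) ^ θ * 2 * C) ^ (1 / θ) with hE_def
  have hE : E ≠ ∞ := by
    refine ENNReal.rpow_ne_top_of_nonneg (by positivity) (ENNReal.mul_ne_top ?_ hC)
    exact ENNReal.mul_ne_top (ENNReal.rpow_ne_top_of_nonneg hθ0.le ENNReal.ofReal_ne_top)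
      ENNReal.ofNat_ne_top
  have h2θ : (2 : ℝ≥0∞) ^ θ ≠ ∞ := ENNReal.rpow_ne_top_of_nonneg hθ0.le ENNReal.ofNat_ne_top
  have hc : 1 + E + 2 ^ θ * C ≠ ∞ :=
    ENNReal.add_ne_top.2 ⟨ENNReal.add_ne_top.2 ⟨ENNReal.one_ne_top, hE⟩, ENNReal.mul_ne_top h2θ hC⟩
  refine ⟨(1 + E + 2 ^ θ * C).toReal, ENNReal.toReal_pos (by simp) hc, fun f hf hfin => ?_⟩
  rw [ENNReal.ofReal_toReal hc]
  have hmix : mixedLpLr p r f < ∞ := lt_of_le_of_lt le_self_add hfin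
  have hsum := lintegral_dyadicDiffSum_le hf (r := r) (p := p) (α := α) hθ
  rw [← hβ_def, ← hC_def] at hsum
  set I := ∫⁻ h in Ioi (0 : ℝ),
    (ENNReal.ofReal (h ^ (-α)) * mixedLpLr p r (Delta1 h f)) ^ θ / ENNReal.ofReal h
  constructor
  · have hsub : ∀ t ∈ Ioc (1 : ℝ) 2,
        eLpNorm f (ENNReal.ofReal p) volume - mixedLpLr p r f ≤ dyadicDiffSum p r f t := by
      intro t ht
      rw [tsub_le_iff_left]
      refine (eLpNorm_le_dyadicDiffSum hf hr hrp (one_pos.trans ht.1) hmix).trans ?_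
      gcongr
      refine mul_le_of_le_one_left' (ENNReal.ofReal_le_one.2 ?_)
      exact Real.rpow_le_one_of_one_le_of_nonpos ht.1.le (neg_nonpos.2 hδ)
    have hroot : eLpNorm f (ENNReal.ofReal p) volume - mixedLpLr p r f ≤ E * I ^ (1 / θ) := by
      rw [hE_def, ← ENNReal.mul_rpow_of_nonneg _ _ (by positivity), one_div,
        ENNReal.le_rpow_inv_iff hθ0, mul_assoc _ C]
      exact (rpow_le_lintegral_weighted hβ.le hθ0.le hsub).trans (by gcongr)
    rw [tsub_le_iff_left] at hroot
    calc eLpNorm f (ENNReal.ofReal p) volume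
        ≤ mixedLpLr p r f + E * I ^ (1 / θ) := hroot
      _ ≤ (1 + E) * mixedLpLr p r f + (1 + E) * I ^ (1 / θ) := by
          gcongr
          · exact le_mul_of_one_le_left' le_self_add
          · exact le_add_self
      _ ≤ _ := by
          rw [← mul_add]
          exact mul_le_mul_left le_self_add _
  · calc ∫⁻ h in Ioi (0 : ℝ), (ENNReal.ofReal (h ^ (-β)) *
          eLpNorm (Delta1 h f) (ENNReal.ofReal p) volume) ^ θ / ENNReal.ofReal h
        ≤ ∫⁻ h in Ioi (0 : ℝ), 2 ^ θ *
            ((ENNReal.ofReal (h ^ (-β)) * dyadicDiffSum p r f h) ^ θ / ENNReal.ofReal h) := by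
          refine setLIntegral_mono' measurableSet_Ioi fun h hh => ?_
          rw [← mul_div_assoc, ← ENNReal.mul_rpow_of_nonneg _ _ hθ0.le, mul_left_comm]
          gcongr
          exact eLpNorm_Delta1_le_dyadicDiffSum hf hr hrp hh hmix
      _ ≤ 2 ^ θ * (C * I) := by
          rw [lintegral_const_mul' _ _ h2θ]
          gcongr
      _ ≤ _ := by
          rw [← mul_assoc]
          gcongr
          exact le_add_self
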